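/- arXiv:2003.03688 — 3 statements merged into one kernel-verified Lean document; each statement's English description precedes it below -/
import Mathlib

section
/- Let A be a right noetherian, fully right bounded ring and let p be a prime (two-sided) ideal of A. Then the following conditions are equivalent: (1) p is an irreducible right ideal of A; (2) the right A-module A/p is compressible; (3) the right A-module A/p is monoform. -/
open MulOpposite

/- We model right `A`-modules as modules over `Aᵐᵒᵖ`, and right ideals of `A` as
`Submodule Aᵐᵒᵖ A` (via `Semiring.toOppositeModule`, where `op r • a = a * r`). -/

/-- A right ideal of `A` is two-sided if it is also closed under left multiplication. -/
def IsTwoSidedRightIdeal {A : Type*} [Ring A] (p : Submodule Aᵐᵒᵖ A) : Prop :=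
  ∀ a ∈ p, ∀ r : A, r * a ∈ p

/-- A prime two-sided ideal of a (noncommutative) ring `A`, viewed as a right ideal:
it is two-sided, proper, and for all `a b`, `a A b ⊆ p` implies `a ∈ p` or `b ∈ p`. -/
def IsPrimeTwoSidedIdeal {A : Type*} [Ring A] (p : Submodule Aᵐᵒᵖ A) : Prop :=
  IsTwoSidedRightIdeal p ∧ p ≠ ⊤ ∧
    ∀ a b : A, (∀ r : A, a * r * b ∈ p) → a ∈ p ∨ b ∈ p

/-- A right ideal `I` of `A` is irreducible if it is not the intersection of two right
ideals each strictly containing it. -/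
def IsIrreducibleRightIdeal {A : Type*} [Ring A] (I : Submodule Aᵐᵒᵖ A) : Prop :=
  ¬∃ J K : Submodule Aᵐᵒᵖ A, I < J ∧ I < K ∧ I = J ⊓ K

/-- `A` is fully right bounded: for every prime two-sided ideal `p`, every essential right
ideal of the ring `A/p` contains a nonzero two-sided ideal of `A/p`.  This is phrased in `A`:
for every right ideal `I ⊇ p` such that `I/p` is essential in `A/p` (every right ideal `K`
strictly containing `p` meets `I` outside of `p`), there is a two-sided ideal `J` with
`p < J ≤ I`. -/
def FullyRightBounded (A : Type*) [Ring A] : Prop :=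
  ∀ p : Submodule Aᵐᵒᵖ A, IsPrimeTwoSidedIdeal p →
    ∀ I : Submodule Aᵐᵒᵖ A, p ≤ I →
      (∀ K : Submodule Aᵐᵒᵖ A, p < K → ¬(I ⊓ K ≤ p)) →
        ∃ J : Submodule Aᵐᵒᵖ A, IsTwoSidedRightIdeal J ∧ p < J ∧ J ≤ I

/-- A nonzero module `M` is compressible if every nonzero submodule of `M` contains a
submodule isomorphic to `M`. -/
def IsCompressible (R M : Type*) [Ring R] [AddCommGroup M] [Module R M] : Prop :=
  (∃ m : M, m ≠ 0) ∧
    ∀ N : Submodule R M, N ≠ ⊥ →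
      ∃ S : Submodule R ↥N, Nonempty (M ≃ₗ[R] ↥S)

/-- A module `H` is monoform if `H ≠ 0` and for every nonzero submodule `N` of `H` there is
no nonzero module isomorphic both to a submodule of `H` and to a submodule of `H/N`. -/
def IsMonoform (R M : Type*) [Ring R] [AddCommGroup M] [Module R M] : Prop :=
  (∃ m : M, m ≠ 0) ∧
    ∀ N : Submodule R M, N ≠ ⊥ →
      ¬∃ (K : Submodule R M) (L : Submodule R (M ⧸ N)),
        K ≠ ⊥ ∧ Nonempty (↥K ≃ₗ[R] ↥L)

section Module

variable {R M : Type*} [Ring R] [AddCommGroup M] [Module R M]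

/-- A noetherian compressible module is uniform. -/
theorem IsCompressible.eq_bot_or_eq_bot_of_disjoint [IsNoetherian R M] (h : IsCompressible R M)
    {N K : Submodule R M} (hNK : Disjoint N K) : N = ⊥ ∨ K = ⊥ := by
  by_contra! hne
  obtain ⟨⟨m, hm⟩, hemb⟩ := h
  obtain ⟨P, ⟨Q, hQ, hPQ⟩, hmax⟩ := set_has_maximal_iff_noetherian.mpr ‹IsNoetherian R M›
    {P : Submodule R M | ∃ Q : Submodule R M, Q ≠ ⊥ ∧ Disjoint P Q}
    ⟨⊥, ⊤, (Submodule.ne_bot_iff _).mpr ⟨m, trivial, hm⟩, disjoint_bot_left⟩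
  obtain ⟨S, ⟨e⟩⟩ := hemb Q hQ
  let f : M →ₗ[R] M := Q.subtype ∘ₗ S.subtype ∘ₗ e.toLinearMap
  have hf : Function.Injective f :=
    Q.injective_subtype.comp (S.injective_subtype.comp e.injective)
  have hfQ (T : Submodule R M) : T.map f ≤ Q := by
    rintro _ ⟨x, -, rfl⟩
    exact (e x : Q).2
  have hbot {T : Submodule R M} (hT : T ≠ ⊥) : T.map f ≠ ⊥ := fun h0 =>
    hT (Submodule.map_injective_of_injective hf (h0.trans (Submodule.map_bot f).symm))
  have hdisj : Disjoint (N.map f) (K.map f) := by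
    rw [disjoint_iff, ← Submodule.map_inf f hf, hNK.eq_bot, Submodule.map_bot]
  have hsup : Disjoint (P ⊔ N.map f) (K.map f) :=
    hdisj.disjoint_sup_left_of_disjoint_sup_right (hPQ.mono_right (sup_le (hfQ N) (hfQ K)))
  have hle : N.map f ≤ P := by
    by_contra hle
    exact hmax _ ⟨K.map f, hbot hne.2, hsup⟩ (left_lt_sup.mpr hle)
  exact hbot hne.1 (le_bot_iff.mp (hPQ hle (hfQ N)))

/-- A monoform module is uniform. -/
theorem IsMonoform.eq_bot_or_eq_bot_of_disjoint (h : IsMonoform R M)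
    {N K : Submodule R M} (hNK : Disjoint N K) : N = ⊥ ∨ K = ⊥ := by
  by_contra! hne
  have hinj : Function.Injective (N.mkQ ∘ₗ K.subtype) := by
    rw [← LinearMap.ker_eq_bot, LinearMap.ker_comp, Submodule.ker_mkQ]
    exact Submodule.disjoint_iff_comap_eq_bot.mp hNK.symm
  exact h.2 N hne.1 ⟨K, _, hne.2, ⟨LinearEquiv.ofInjective _ hinj⟩⟩

end Module

section RightIdeal

variable {A : Type*} [Ring A] {p : Submodule Aᵐᵒᵖ A}

/-- A right ideal is irreducible if and only if its quotient module is uniform or zero. -/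
theorem isIrreducibleRightIdeal_iff_forall_disjoint :
    IsIrreducibleRightIdeal p ↔
      ∀ N K : Submodule Aᵐᵒᵖ (A ⧸ p), Disjoint N K → N = ⊥ ∨ K = ⊥ := by
  have hcomap : (⊥ : Submodule Aᵐᵒᵖ (A ⧸ p)).comap p.mkQ = p := by
    rw [← LinearMap.ker, Submodule.ker_mkQ]
  constructor
  · intro h N K hNK
    by_contra! hne
    have hlt {T : Submodule Aᵐᵒᵖ (A ⧸ p)} (hT : T ≠ ⊥) : p < T.comap p.mkQ := by
      refine lt_of_le_of_ne (Submodule.le_comap_mkQ p T) fun heq => hT ?_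
      exact Submodule.comap_injective_of_surjective p.mkQ_surjective (heq.symm.trans hcomap.symm)
    exact h ⟨_, _, hlt hne.1, hlt hne.2, by
      rw [← Submodule.comap_inf, hNK.eq_bot, hcomap]⟩
  · rintro h ⟨J, K, hJ, hK, heq⟩
    have hbot {T : Submodule Aᵐᵒᵖ A} (hT : p < T) : T.map p.mkQ ≠ ⊥ := fun h0 => hT.not_ge <| by
      rwa [← le_bot_iff, Submodule.map_le_iff_le_comap, hcomap] at h0
    refine (h (J.map p.mkQ) (K.map p.mkQ) ?_).elim (hbot hJ) (hbot hK)
    rw [disjoint_iff]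
    apply Submodule.comap_injective_of_surjective p.mkQ_surjective
    rw [Submodule.comap_inf, Submodule.comap_map_mkQ, Submodule.comap_map_mkQ,
      sup_eq_right.mpr hJ.le, sup_eq_right.mpr hK.le, hcomap, ← heq]

/-- Over a fully right bounded ring, the quotient by a prime ideal which is irreducible as a
right ideal has no zero divisors. -/
theorem IsPrimeTwoSidedIdeal.mem_or_mem_of_mul_mem (hfb : FullyRightBounded A)
    (hp : IsPrimeTwoSidedIdeal p) (hirr : IsIrreducibleRightIdeal p) {a b : A}
    (hab : a * b ∈ p) : a ∈ p ∨ b ∈ p := by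
  by_contra! hne
  let I : Submodule Aᵐᵒᵖ A := p.comap (LinearMap.mulLeft Aᵐᵒᵖ a)
  have hpI : p ≤ I := fun x hx => hp.1 x hx a
  have hlt : p < I := SetLike.lt_iff_le_and_exists.mpr ⟨hpI, b, hab, hne.2⟩
  obtain ⟨J, hJ, hpJ, hJI⟩ := hfb p hp I hpI fun K hK hle =>
    hirr ⟨I, K, hlt, hK, le_antisymm (le_inf hpI hK.le) hle⟩
  obtain ⟨-, j, hj, hjp⟩ := SetLike.lt_iff_le_and_exists.mp hpJ
  refine (hp.2.2 a j fun r => ?_).elim hne.1 hjp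
  rw [mul_assoc]
  exact hJI (hJ j hj r)

theorem isCompressible_quotient_of_mem_or_mem (hp : IsPrimeTwoSidedIdeal p)
    (hdom : ∀ a b : A, a * b ∈ p → a ∈ p ∨ b ∈ p) : IsCompressible Aᵐᵒᵖ (A ⧸ p) := by
  have := Submodule.Quotient.nontrivial_iff.mpr hp.2.1
  refine ⟨exists_ne 0, fun N hN => ?_⟩
  obtain ⟨x, hxN, hx⟩ := (Submodule.ne_bot_iff N).mp hN
  obtain ⟨a, rfl⟩ := p.mkQ_surjective x
  have ha : a ∉ p := fun ha => hx ((Submodule.Quotient.mk_eq_zero p).mpr ha)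
  let f : (A ⧸ p) →ₗ[Aᵐᵒᵖ] (A ⧸ p) :=
    p.mapQ p (LinearMap.mulLeft Aᵐᵒᵖ a) fun y hy => hp.1 y hy a
  have hfN (y : A ⧸ p) : f y ∈ N := by
    obtain ⟨r, rfl⟩ := p.mkQ_surjective y
    exact N.smul_mem (op r) hxN
  have hf : Function.Injective (f.codRestrict N hfN) := by
    rw [← LinearMap.ker_eq_bot, LinearMap.ker_codRestrict, LinearMap.ker_eq_bot']
    intro y hy
    obtain ⟨r, rfl⟩ := p.mkQ_surjective y
    have har : a * r ∈ p := (Submodule.Quotient.mk_eq_zero p).mp hy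
    exact (Submodule.Quotient.mk_eq_zero p).mpr ((hdom a r har).resolve_left ha)
  exact ⟨_, ⟨LinearEquiv.ofInjective _ hf⟩⟩

theorem isMonoform_quotient_of_mem_or_mem (hp : IsPrimeTwoSidedIdeal p)
    (hirr : IsIrreducibleRightIdeal p)
    (hdom : ∀ a b : A, a * b ∈ p → a ∈ p ∨ b ∈ p) : IsMonoform Aᵐᵒᵖ (A ⧸ p) := by
  have := Submodule.Quotient.nontrivial_iff.mpr hp.2.1
  refine ⟨exists_ne 0, ?_⟩
  rintro N hN ⟨K, L, hK, ⟨e⟩⟩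
  have htors (x : A ⧸ p) : ∃ c ∉ p, op c • x ∈ N := by
    by_cases hx : x = 0
    · obtain ⟨c, -, hc⟩ := SetLike.exists_of_lt hp.2.1.lt_top
      exact ⟨c, hc, by simp [hx]⟩
    have hnd : ¬ Disjoint (Submodule.span Aᵐᵒᵖ {x}) N := fun hd =>
      (isIrreducibleRightIdeal_iff_forall_disjoint.mp hirr _ _ hd).elim
        (fun h0 => hx (Submodule.span_singleton_eq_bot.mp h0)) hN
    rw [disjoint_iff] at hnd
    obtain ⟨y, ⟨hy, hyN⟩, hy0⟩ := (Submodule.ne_bot_iff _).mp hnd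
    obtain ⟨r, rfl⟩ := Submodule.mem_span_singleton.mp hy
    refine ⟨unop r, fun hr => hy0 ?_, hyN⟩
    obtain ⟨b, rfl⟩ := p.mkQ_surjective x
    exact (Submodule.Quotient.mk_eq_zero p).mpr (hp.1 _ hr b)
  obtain ⟨k, hk, hk0⟩ := (Submodule.ne_bot_iff K).mp hK
  obtain ⟨x, hx⟩ := N.mkQ_surjective (e ⟨k, hk⟩ : (A ⧸ p) ⧸ N)
  obtain ⟨c, hc, hcx⟩ := htors x
  have hzero : op c • (⟨k, hk⟩ : K) = 0 := by
    apply e.injective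
    rw [map_smul, map_zero]
    apply Subtype.ext
    rw [Submodule.coe_smul, ← hx, ← map_smul]
    exact (Submodule.Quotient.mk_eq_zero N).mpr hcx
  obtain ⟨a, rfl⟩ := p.mkQ_surjective k
  have hac : a * c ∈ p := (Submodule.Quotient.mk_eq_zero p).mp (congrArg Subtype.val hzero)
  exact (hdom a c hac).elim (fun ha => hk0 ((Submodule.Quotient.mk_eq_zero p).mpr ha)) hc

end RightIdeal

/-- For a right noetherian, fully right bounded ring `A` and a prime two-sided
ideal `p` of `A`, the following are equivalent: (1) `p` is an irreducible right ideal;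
(2) the right `A`-module `A/p` is compressible; (3) the right `A`-module `A/p` is monoform. -/
theorem fbr_prime_irreducible_iff_compressible_iff_monoform
    {A : Type*} [Ring A] (_hnoeth : IsNoetherian Aᵐᵒᵖ A) (_hfbn : FullyRightBounded A)
    (p : Submodule Aᵐᵒᵖ A) (hp : IsPrimeTwoSidedIdeal p) :
    List.TFAE [IsIrreducibleRightIdeal p,
      IsCompressible Aᵐᵒᵖ (A ⧸ p),
      IsMonoform Aᵐᵒᵖ (A ⧸ p)] := by
  tfae_have 1 → 2 := fun hirr => isCompressible_quotient_of_mem_or_mem hp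
    fun _ _ => hp.mem_or_mem_of_mul_mem _hfbn hirr
  tfae_have 1 → 3 := fun hirr => isMonoform_quotient_of_mem_or_mem hp hirr
    fun _ _ => hp.mem_or_mem_of_mul_mem _hfbn hirr
  tfae_have 2 → 1 := fun h => isIrreducibleRightIdeal_iff_forall_disjoint.mpr
    fun _ _ => h.eq_bot_or_eq_bot_of_disjoint
  tfae_have 3 → 1 := fun h => isIrreducibleRightIdeal_iff_forall_disjoint.mpr
    fun _ _ => h.eq_bot_or_eq_bot_of_disjoint
  tfae_finish
end

section
/- Let A be a right noetherian, fully right bounded ring. Then every monoform right A-module M contains a submodule H which is compressible (and hence also monoform). -/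
open MulOpposite

section Monoform

variable {R M P : Type*} [Ring R] [AddCommGroup M] [Module R M] [AddCommGroup P] [Module R P]

theorem IsMonoform.ker_le_ker (hM : IsMonoform R M) {f g : P →ₗ[R] M}
    (hfg : LinearMap.ker f ≤ LinearMap.ker g) (hg : g ≠ 0) :
    LinearMap.ker g ≤ LinearMap.ker f := by
  by_contra h
  have hN : (LinearMap.ker g).map f ≠ ⊥ := fun h0 ↦ h (LinearMap.le_ker_iff_map.2 h0)
  have hker : LinearMap.ker g =
      LinearMap.ker (((LinearMap.ker g).map f).mkQ ∘ₗ f) := by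
    rw [LinearMap.ker_comp, Submodule.ker_mkQ, Submodule.comap_map_eq, sup_eq_left.2 hfg]
  exact hM.2 _ hN ⟨LinearMap.range g, LinearMap.range (((LinearMap.ker g).map f).mkQ ∘ₗ f),
    fun h0 ↦ hg (LinearMap.range_eq_bot.1 h0),
    ⟨g.quotKerEquivRange.symm ≪≫ₗ Submodule.quotEquivOfEq _ _ hker ≪≫ₗ
      LinearMap.quotKerEquivRange _⟩⟩

theorem IsMonoform.submodule (hM : IsMonoform R M) {H : Submodule R M} (hH : H ≠ ⊥) :
    IsMonoform R H := by
  refine ⟨?_, fun N hN ⟨K, L, hK, ⟨e⟩⟩ ↦ ?_⟩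
  · obtain ⟨m, hm, hm0⟩ := H.ne_bot_iff.1 hH
    exact ⟨⟨m, hm⟩, fun h ↦ hm0 (congrArg Subtype.val h)⟩
  have hinj : Function.Injective
      (N.mapQ (N.map H.subtype) H.subtype (Submodule.le_comap_map _ _)) := by
    rw [← LinearMap.ker_eq_bot, Submodule.mapQ, Submodule.ker_liftQ_eq_bot']
    rw [LinearMap.ker_comp, Submodule.ker_mkQ,
      Submodule.comap_map_eq_of_injective H.injective_subtype]
  have hbot {S : Submodule R H} (hS : S ≠ ⊥) : S.map H.subtype ≠ ⊥ := fun h ↦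
    hS (Submodule.map_injective_of_injective H.injective_subtype
      (h.trans (Submodule.map_bot _).symm))
  exact hM.2 (N.map H.subtype) (hbot hN) ⟨K.map H.subtype, L.map _, hbot hK,
    ⟨(Submodule.equivMapOfInjective _ H.injective_subtype K).symm ≪≫ₗ e ≪≫ₗ
      Submodule.equivMapOfInjective _ hinj L⟩⟩

theorem IsMonoform.exists_equiv_submodule (hM : IsMonoform R M) {H : Submodule R M}
    {N : Submodule R H} {f : P →ₗ[R] H} {g : P →ₗ[R] N} (hf : Function.Surjective f)
    (hfg : LinearMap.ker f ≤ LinearMap.ker g) (hg : g ≠ 0) :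
    ∃ S : Submodule R N, Nonempty (H ≃ₗ[R] S) := by
  have hi : LinearMap.ker (H.subtype ∘ₗ N.subtype) = ⊥ :=
    LinearMap.ker_eq_bot_of_injective (H.injective_subtype.comp N.injective_subtype)
  have hf' : LinearMap.ker (H.subtype ∘ₗ f) = LinearMap.ker f :=
    LinearMap.ker_comp_of_ker_eq_bot f H.ker_subtype
  have hg' : LinearMap.ker ((H.subtype ∘ₗ N.subtype) ∘ₗ g) = LinearMap.ker g :=
    LinearMap.ker_comp_of_ker_eq_bot g hi
  have hne : (H.subtype ∘ₗ N.subtype) ∘ₗ g ≠ 0 := fun h ↦ hg <| LinearMap.ker_eq_top.1 <|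
    hg'.symm.trans (LinearMap.ker_eq_top.2 h)
  have hgf := hM.ker_le_ker (f := H.subtype ∘ₗ f) (by rwa [hf', hg']) hne
  rw [hf', hg'] at hgf
  exact ⟨LinearMap.range g, ⟨(f.quotKerEquivOfSurjective hf).symm ≪≫ₗ
    Submodule.quotEquivOfEq _ _ (le_antisymm hfg hgf) ≪≫ₗ g.quotKerEquivRange⟩⟩

end Monoform

section RightAnnihilator

variable {A M : Type*} [Ring A] [AddCommGroup M] [Module Aᵐᵒᵖ M]

/-- The map `a ↦ x a` from `A` to a right `A`-module. -/
def rightOrbitMap (x : M) : A →ₗ[Aᵐᵒᵖ] M where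
  toFun a := op a • x
  map_add' a b := by rw [op_add, add_smul]
  map_smul' r a := mul_smul r (op a) x

@[simp]
theorem rightOrbitMap_apply (x : M) (a : A) : rightOrbitMap x a = op a • x := rfl

/-- The annihilator in `A` of a submodule of a right `A`-module, as a right ideal. -/
def rightAnnihilator (U : Submodule Aᵐᵒᵖ M) : Submodule Aᵐᵒᵖ A :=
  ⨅ u : U, LinearMap.ker (rightOrbitMap (u : M))

theorem mem_rightAnnihilator {U : Submodule Aᵐᵒᵖ M} {a : A} :
    a ∈ rightAnnihilator U ↔ ∀ u ∈ U, op a • u = 0 := by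
  simp [rightAnnihilator]

theorem rightAnnihilator_anti {U V : Submodule Aᵐᵒᵖ M} (h : U ≤ V) :
    (rightAnnihilator V : Submodule Aᵐᵒᵖ A) ≤ rightAnnihilator U := fun _ ha ↦
  mem_rightAnnihilator.2 fun u hu ↦ mem_rightAnnihilator.1 ha u (h hu)

theorem isTwoSidedRightIdeal_rightAnnihilator (U : Submodule Aᵐᵒᵖ M) :
    IsTwoSidedRightIdeal (rightAnnihilator U) := fun a ha r ↦
  mem_rightAnnihilator.2 fun u hu ↦ by
    rw [op_mul, mul_smul]
    exact mem_rightAnnihilator.1 ha _ (U.smul_mem _ hu)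

theorem isPrimeTwoSidedIdeal_rightAnnihilator {U : Submodule Aᵐᵒᵖ M} (hU : U ≠ ⊥)
    (hmax : ∀ V ≤ U, V ≠ ⊥ →
      (rightAnnihilator V : Submodule Aᵐᵒᵖ A) = rightAnnihilator U) :
    IsPrimeTwoSidedIdeal (rightAnnihilator U) := by
  refine ⟨isTwoSidedRightIdeal_rightAnnihilator U, fun h ↦ hU ?_, fun a b hab ↦ ?_⟩
  · refine U.eq_bot_iff.2 fun u hu ↦ ?_
    simpa using mem_rightAnnihilator.1 (h ▸ Submodule.mem_top : (1 : A) ∈ rightAnnihilator U) u hu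
  by_contra! h
  obtain ⟨ha, hb⟩ := h
  rw [mem_rightAnnihilator] at ha
  push Not at ha
  obtain ⟨u, hu, hau⟩ := ha
  have hle : Submodule.span Aᵐᵒᵖ {op a • u} ≤ U := by
    simpa using U.smul_mem _ hu
  refine hb (hmax _ hle (by simpa using hau) ▸ mem_rightAnnihilator.2 fun v hv ↦ ?_)
  obtain ⟨r, rfl⟩ := Submodule.mem_span_singleton.1 hv
  have := mem_rightAnnihilator.1 (hab r.unop) u hu
  rwa [op_mul, op_mul, op_unop, mul_smul, mul_smul] at this

theorem exists_rightAnnihilator_maximal [Nontrivial M] (hA : IsNoetherian Aᵐᵒᵖ A) :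
    ∃ U : Submodule Aᵐᵒᵖ M, U ≠ ⊥ ∧ ∀ V ≤ U, V ≠ ⊥ →
      (rightAnnihilator V : Submodule Aᵐᵒᵖ A) = rightAnnihilator U := by
  obtain ⟨_, ⟨U, hU, rfl⟩, hmax⟩ := set_has_maximal_iff_noetherian.2 hA
    (Set.image rightAnnihilator {U : Submodule Aᵐᵒᵖ M | U ≠ ⊥}) ⟨_, ⊤, top_ne_bot, rfl⟩
  exact ⟨U, hU, fun V hV hV0 ↦
    ((rightAnnihilator_anti hV).eq_of_not_lt (hmax _ ⟨V, hV0, rfl⟩)).symm⟩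

/-- In a monoform module, a submodule `x K` with `K` a right ideal meeting the annihilator of `x`
in a prime ideal `p` annihilating `x` and strictly contained in `K` is compressible. -/
theorem IsMonoform.isCompressible_map_rightOrbitMap (hM : IsMonoform Aᵐᵒᵖ M)
    {p K : Submodule Aᵐᵒᵖ A} (hp : IsPrimeTwoSidedIdeal p) {x : M}
    (hpx : p ≤ LinearMap.ker (rightOrbitMap x)) (hpK : p < K)
    (hK : LinearMap.ker (rightOrbitMap x) ⊓ K ≤ p) :
    IsCompressible Aᵐᵒᵖ (K.map (rightOrbitMap x)) := by
  obtain ⟨l, hlK, hlp⟩ := SetLike.exists_of_lt hpK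
  refine ⟨⟨⟨_, Submodule.mem_map_of_mem hlK⟩,
    fun h ↦ hlp (hK ⟨congrArg Subtype.val h, hlK⟩)⟩, fun N hN ↦ ?_⟩
  obtain ⟨⟨_, k, hkK, rfl⟩, hkN, hk0⟩ := N.ne_bot_iff.1 hN
  have hkp : k ∉ p := fun h ↦ hk0 (Subtype.ext (hpx h))
  obtain ⟨r, hr⟩ : ∃ r, k * r * l ∉ p := by
    by_contra! h
    exact (hp.2.2 k l h).elim hkp hlp
  let y : N := op r • ⟨_, hkN⟩
  let g : K →ₗ[Aᵐᵒᵖ] N := rightOrbitMap y ∘ₗ K.subtype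
  have hg (c : K) : (g c : M) = rightOrbitMap x (k * r * c) := by
    simp [g, y, mul_smul]
  refine hM.exists_equiv_submodule (g := g) ((rightOrbitMap x).submoduleMap_surjective K)
    (fun c hc ↦ ?_) fun h ↦ ?_
  · have hcp : (c : A) ∈ p := hK ⟨congrArg Subtype.val hc, c.2⟩
    exact Subtype.ext (Subtype.ext ((hg c).trans (hpx (hp.1 _ hcp _))))
  · have h0 : rightOrbitMap x (k * r * l) = 0 := by
      rw [← hg ⟨l, hlK⟩, h]
      rfl
    refine hr (hK ⟨h0, ?_⟩)
    simpa [mul_assoc] using K.smul_mem (op (r * l)) hkK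

end RightAnnihilator

/-- If `A` is a right noetherian, fully right bounded ring, then every monoform
right `A`-module `M` contains a submodule `H` which is compressible (and hence monoform). -/
theorem monoform_contains_compressible
    {A M : Type*} [Ring A] [AddCommGroup M] [Module Aᵐᵒᵖ M]
    (_hnoeth : IsNoetherian Aᵐᵒᵖ A) (_hfbn : FullyRightBounded A)
    (hM : IsMonoform Aᵐᵒᵖ M) :
    ∃ H : Submodule Aᵐᵒᵖ M, IsCompressible Aᵐᵒᵖ ↥H ∧ IsMonoform Aᵐᵒᵖ ↥H := by
  obtain ⟨m, hm⟩ := hM.1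
  have : Nontrivial M := ⟨m, 0, hm⟩
  obtain ⟨U, hU, hmax⟩ := exists_rightAnnihilator_maximal (M := M) _hnoeth
  obtain ⟨x, hxU, hx⟩ := U.ne_bot_iff.1 hU
  have hp := isPrimeTwoSidedIdeal_rightAnnihilator hU hmax
  have hpx : rightAnnihilator U ≤ LinearMap.ker (rightOrbitMap x) := fun a ha ↦
    mem_rightAnnihilator.1 ha x hxU
  obtain ⟨K, hpK, hK⟩ : ∃ K : Submodule Aᵐᵒᵖ A, rightAnnihilator U < K ∧
      LinearMap.ker (rightOrbitMap x) ⊓ K ≤ rightAnnihilator U := by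
    by_contra! h
    obtain ⟨J, hJ, hpJ, hJx⟩ := _hfbn _ hp _ hpx h
    refine hpJ.not_ge ?_
    rw [← hmax (Submodule.span Aᵐᵒᵖ {x}) (by simpa using hxU) (by simpa using hx)]
    refine fun a ha ↦ mem_rightAnnihilator.2 fun v hv ↦ ?_
    obtain ⟨r, rfl⟩ := Submodule.mem_span_singleton.1 hv
    have h0 : op (r.unop * a) • x = 0 := hJx (hJ a ha r.unop)
    rwa [op_mul, op_unop, mul_smul] at h0
  have hH := hM.isCompressible_map_rightOrbitMap hp hpx hpK hK
  refine ⟨_, hH, hM.submodule fun h ↦ ?_⟩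
  obtain ⟨v, hv⟩ := hH.1
  exact hv (Subtype.ext ((Submodule.eq_bot_iff _).1 h v v.2))
end

section
/- Let A be a ring, let H be a monoform right A-module, and let E be an injective right A-module containing H as an essential submodule. Then for every nonzero right A-module M, one has Hom_A(M, E) ≠ 0 if and only if there exist submodules K ⊆ L of M such that the subquotient L/K is isomorphic to a nonzero submodule of H. (This expresses that the atom support of M consists exactly of those atoms α for which Hom_A(M, E(α)) ≠ 0.) -/
universe u

/-- Let `A` be a ring, `H` a monoform right `A`-module (a module over `Aᵐᵒᵖ`),
and `E` an injective right `A`-module containing `H` as an essential submodule.  Then for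
every nonzero right `A`-module `M` we have `Hom_A(M, E) ≠ 0` iff there exist submodules
`K ⊆ L` of `M` such that the subquotient `L/K` is isomorphic to a nonzero submodule of `H`. -/
theorem hom_to_injective_envelope_ne_zero_iff
    {A : Type u} [Ring A] (E : Type u) [AddCommGroup E] [Module Aᵐᵒᵖ E]
    (_hEinj : Module.Injective Aᵐᵒᵖ E) (H : Submodule Aᵐᵒᵖ E)
    (_hH : IsMonoform Aᵐᵒᵖ ↥H)
    (_hess : ∀ K : Submodule Aᵐᵒᵖ E, K ≠ ⊥ → H ⊓ K ≠ ⊥)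
    (M : Type u) [AddCommGroup M] [Module Aᵐᵒᵖ M] (_hM : ∃ m : M, m ≠ 0) :
    (∃ f : M →ₗ[Aᵐᵒᵖ] E, f ≠ 0) ↔
      ∃ K L : Submodule Aᵐᵒᵖ M, K ≤ L ∧
        ∃ S : Submodule Aᵐᵒᵖ ↥H, S ≠ ⊥ ∧
          Nonempty ((↥L ⧸ Submodule.comap L.subtype K) ≃ₗ[Aᵐᵒᵖ] ↥S) := by
  constructor
  · rintro ⟨f, hf⟩
    let g : ↥(H.comap f) →ₗ[Aᵐᵒᵖ] ↥H := f.restrict fun _ hx => hx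
    have hker : Submodule.comap (H.comap f).subtype (LinearMap.ker f) = LinearMap.ker g := by
      ext x
      simp [g, Subtype.ext_iff]
    refine ⟨LinearMap.ker f, H.comap f, ?_, LinearMap.range g, ?_,
      ⟨(Submodule.quotEquivOfEq _ _ hker).trans g.quotKerEquivRange⟩⟩
    · intro x hx
      rw [Submodule.mem_comap, LinearMap.mem_ker.mp hx]
      exact H.zero_mem
    · obtain ⟨y, ⟨hyH, x, rfl⟩, hy⟩ :=
        Submodule.exists_mem_ne_zero_of_ne_bot
          (_hess (LinearMap.range f) (mt LinearMap.range_eq_bot.mp hf))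
      exact (Submodule.ne_bot_iff _).mpr ⟨g ⟨x, hyH⟩, ⟨_, rfl⟩, fun h => hy (congrArg Subtype.val h)⟩
  · rintro ⟨K, L, -, S, hS, ⟨e⟩⟩
    let g : ↥L →ₗ[Aᵐᵒᵖ] E :=
      H.subtype ∘ₗ S.subtype ∘ₗ e.toLinearMap ∘ₗ (Submodule.comap L.subtype K).mkQ
    obtain ⟨f, hf⟩ := _hEinj.out L.subtype L.injective_subtype g
    obtain ⟨s, hsS, hs⟩ := Submodule.exists_mem_ne_zero_of_ne_bot hS
    obtain ⟨x, hx⟩ := Submodule.mkQ_surjective _ (e.symm ⟨s, hsS⟩)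
    refine ⟨f, ?_⟩
    rintro rfl
    have hgx : g x = (s : E) := by
      simp only [g, LinearMap.comp_apply, hx]
      simp
    exact hs (Subtype.ext (hgx.symm.trans (hf x).symm))
end
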